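/- For every r ≥ 0, every Z_r-quasi-isomorphism of filtered complexes is an E_r-quasi-isomorphism. -/

import Mathlib

open scoped Classical

/-- A filtered (cochain) complex of `R`-modules, with differentials given in
"all indices" form: `d i j` is the differential `X i → X j`, which vanishes
unless `j = i + 1`. The filtration `F n` on `X n` is increasing and preserved
by the differential. -/
structure FilteredComplex (R : Type) [CommRing R] where
  X : ℤ → Type
  [addgrp : ∀ n, AddCommGroup (X n)]
  [mod : ∀ n, Module R (X n)]
  d : ∀ i j : ℤ, X i →ₗ[R] X j
  d_ne : ∀ i j, j ≠ i + 1 → d i j = 0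
  d_sq : ∀ i j k x, d j k (d i j x) = 0
  F : ∀ n, ℤ → Submodule R (X n)
  F_mono : ∀ n, Monotone (F n)
  d_filt : ∀ i j p x, x ∈ F i p → d i j x ∈ F j p

attribute [instance] FilteredComplex.addgrp FilteredComplex.mod

variable {R : Type} [CommRing R]

/-- The `r`-cycles `Z_r^{p,n+p}(A) = F_p A^n ∩ d⁻¹(F_{p-r} A^{n+1})`. -/
def Zc (A : FilteredComplex R) (r : ℕ) (p n : ℤ) : Submodule R (A.X n) :=
  A.F n p ⊓ (A.F (n+1) (p - (r:ℤ))).comap (A.d n (n+1))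

/-- The `r`-boundaries `B_r^{p,n+p}(A) = Z_{r-1}^{p-1,n+p-1}(A) + d Z_{r-1}^{p+r-1,n+p+r-2}(A)`
(for `r ≥ 1`; for `r = 0` this agrees with `B_0 = Z_0^{p-1}`). -/
def Bd (A : FilteredComplex R) (r : ℕ) (p n : ℤ) : Submodule R (A.X n) :=
  Zc A (r-1) (p-1) n ⊔ (Zc A (r-1) (p + (r:ℤ) - 1) (n-1)).map (A.d (n-1) n)

/-- Morphisms of filtered complexes. -/
structure FCHom (A B : FilteredComplex R) where
  f : ∀ n, A.X n →ₗ[R] B.X n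
  comm : ∀ i j x, f j (A.d i j x) = B.d i j (f i x)
  filt : ∀ n p x, x ∈ A.F n p → f n x ∈ B.F n p

def FCHom.comp {A B C : FilteredComplex R} (g : FCHom B C) (φ : FCHom A B) : FCHom A C where
  f := fun n => (g.f n).comp (φ.f n)
  comm := by intro i j x; simp [LinearMap.comp_apply, φ.comm, g.comm]
  filt := fun n p x hx => g.filt n p _ (φ.filt n p x hx)

def FCHom.id' (A : FilteredComplex R) : FCHom A A :=
  ⟨fun _ => LinearMap.id, fun _ _ _ => rfl, fun _ _ _ hx => hx⟩

def FCHom.zero (A B : FilteredComplex R) : FCHom A B :=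
  ⟨fun _ => 0, by intro i j x; simp, by intro n p x _; simp⟩

/-- `Z_r(φ)` is bidegree-wise surjective. -/
def ZSurjF {A B : FilteredComplex R} (φ : FCHom A B) (r : ℕ) : Prop :=
  ∀ p n, ∀ b ∈ Zc B r p n, ∃ a ∈ Zc A r p n, φ.f n a = b

/-- `E_r(φ)` is bidegree-wise surjective (elementwise formulation, `r ≥ 1` pages). -/
def ESurjF {A B : FilteredComplex R} (φ : FCHom A B) (r : ℕ) : Prop :=
  ∀ p n, ∀ b ∈ Zc B r p n, ∃ a ∈ Zc A r p n, φ.f n a - b ∈ Bd B r p n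

/-- `E_r(φ)` is bidegree-wise injective (elementwise formulation). -/
def EInjF {A B : FilteredComplex R} (φ : FCHom A B) (r : ℕ) : Prop :=
  ∀ p n, ∀ a ∈ Zc A r p n, φ.f n a ∈ Bd B r p n → a ∈ Bd A r p n

/-- `φ` is an `E_r`-quasi-isomorphism: `E_{r+1}(φ)` is an isomorphism. -/
def IsErQisF {A B : FilteredComplex R} (φ : FCHom A B) (r : ℕ) : Prop :=
  ESurjF φ (r+1) ∧ EInjF φ (r+1)

/-- The `r`-shift `S^r`: `(S^r F)_p A^n = F_{p + r n} A^n`. -/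
def Shift (r : ℕ) (A : FilteredComplex R) : FilteredComplex R :=
  { A with
    F := fun n p => A.F n (p + (r:ℤ) * n)
    F_mono := fun n _ _ h => A.F_mono n (by omega)
    d_filt := by
      intro i j p x hx
      by_cases h : j = i + 1
      · subst h
        refine A.F_mono (i+1) ?_ (A.d_filt i (i+1) _ x hx)
        have hr : (0:ℤ) ≤ (r:ℤ) := Int.natCast_nonneg r
        nlinarith
      · rw [A.d_ne i j h]; simp }

/-- The `r`-décalage `Dec^r`: `(Dec^r F)_p A^n = F_{p - rn} A^n ∩ d⁻¹(F_{p-r(n+1)} A^{n+1})`. -/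
def Dec (r : ℕ) (A : FilteredComplex R) : FilteredComplex R :=
  { A with
    F := fun n p => A.F n (p - (r:ℤ) * n) ⊓
      (A.F (n+1) (p - (r:ℤ) * (n+1))).comap (A.d n (n+1))
    F_mono := fun n a b h => inf_le_inf (A.F_mono n (by omega))
      (Submodule.comap_mono (A.F_mono (n+1) (by omega)))
    d_filt := by
      intro i j p x hx
      by_cases h : j = i + 1
      · subst h
        rw [Submodule.mem_inf] at hx ⊢
        refine ⟨hx.2, ?_⟩
        rw [Submodule.mem_comap, A.d_sq]
        exact Submodule.zero_mem _
      · rw [A.d_ne i j h]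
        exact Submodule.zero_mem _ }

/-- Shift of a morphism. -/
def ShiftHom (r : ℕ) {A B : FilteredComplex R} (φ : FCHom A B) :
    FCHom (Shift r A) (Shift r B) :=
  ⟨φ.f, φ.comm, fun n p x hx => φ.filt n (p + (r:ℤ) * n) x hx⟩

theorem Zc_mono (A : FilteredComplex R) (r : ℕ) {p q : ℤ} (n : ℤ) (h : p ≤ q) :
    Zc A r p n ≤ Zc A r q n :=
  inf_le_inf (A.F_mono n h) (Submodule.comap_mono (A.F_mono (n+1) (by omega)))

theorem Zc_succ_le (A : FilteredComplex R) (r : ℕ) (p n : ℤ) :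
    Zc A (r+1) p n ≤ Zc A r p n :=
  inf_le_inf le_rfl (Submodule.comap_mono (A.F_mono (n+1) (by push_cast; omega)))

theorem d_mem_Zc_of_mem_Zc_succ (A : FilteredComplex R) {r : ℕ} {p n : ℤ} {x : A.X n}
    (hx : x ∈ Zc A (r+1) p n) : A.d n (n+1) x ∈ Zc A r (p - 1 - r) (n+1) := by
  refine ⟨A.F_mono _ (by push_cast; omega) hx.2, ?_⟩
  rw [SetLike.mem_coe, Submodule.mem_comap, A.d_sq]
  exact Submodule.zero_mem _

theorem mem_Zc_succ_of_d_mem_Zc (A : FilteredComplex R) {r : ℕ} {p n : ℤ} {x : A.X n}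
    (hx : x ∈ Zc A r p n) (hd : A.d n (n+1) x ∈ Zc A r (p - 1 - r) (n+1)) :
    x ∈ Zc A (r+1) p n :=
  ⟨hx.1, A.F_mono _ (by push_cast; omega) hd.1⟩

theorem FCHom.map_mem_Zc {A B : FilteredComplex R} (φ : FCHom A B) {r : ℕ} {p n : ℤ} {x : A.X n}
    (hx : x ∈ Zc A r p n) : φ.f n x ∈ Zc B r p n := by
  refine ⟨φ.filt n p x hx.1, ?_⟩
  rw [SetLike.mem_coe, Submodule.mem_comap, ← φ.comm]
  exact φ.filt _ _ _ hx.2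

theorem mem_Bd_succ {A : FilteredComplex R} {r : ℕ} {p n : ℤ} {x : A.X n} :
    x ∈ Bd A (r+1) p n ↔
      ∃ y ∈ Zc A r (p-1) n, ∃ z ∈ Zc A r (p+r) (n-1), y + A.d (n-1) n z = x := by
  have h : p + ((r + 1 : ℕ) : ℤ) - 1 = p + r := by push_cast; ring
  simp only [Bd, h, Nat.add_sub_cancel, Submodule.mem_sup, Submodule.mem_map,
    exists_exists_and_eq_and]

/-- Every `Z_r`-quasi-isomorphism (i.e. `Z_r(f)` is a quasi-isomorphism of
`r`-bigraded complexes, where the differential on `Z_r` is induced by `d`)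
is an `E_r`-quasi-isomorphism. -/
theorem stmt9 {R : Type} [CommRing R] {A B : FilteredComplex R} (φ : FCHom A B) (r : ℕ)
    (hsurj : ∀ p n, ∀ b ∈ Zc B r p n, B.d n (n+1) b = 0 →
      ∃ a ∈ Zc A r p n, A.d n (n+1) a = 0 ∧
        ∃ c ∈ Zc B r (p + (r:ℤ)) (n-1), φ.f n a - b = B.d (n-1) n c)
    (hinj : ∀ p n, ∀ a ∈ Zc A r p n, A.d n (n+1) a = 0 →
      (∃ c ∈ Zc B r (p + (r:ℤ)) (n-1), φ.f n a = B.d (n-1) n c) →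
      ∃ c' ∈ Zc A r (p + (r:ℤ)) (n-1), a = A.d (n-1) n c') :
    IsErQisF φ r := by
  have hsurj' : ∀ p q n m, q = p + (r:ℤ) → n - 1 = m → ∀ b ∈ Zc B r p n, B.d n (n+1) b = 0 →
      ∃ a ∈ Zc A r p n, A.d n (n+1) a = 0 ∧
        ∃ c ∈ Zc B r q m, φ.f n a - b = B.d m n c := by
    rintro p _ n _ rfl rfl
    exact hsurj p n
  have hinj' : ∀ p q n m, q = p + (r:ℤ) → n - 1 = m → ∀ a ∈ Zc A r p n, A.d n (n+1) a = 0 →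
      ∀ c ∈ Zc B r q m, φ.f n a = B.d m n c → ∃ c' ∈ Zc A r q m, a = A.d m n c' := by
    rintro p _ n _ rfl rfl a ha hda c hc hac
    exact hinj p n a ha hda ⟨c, hc, hac⟩
  constructor
  · intro p n b hb
    obtain ⟨a₁, ha₁, hda₁, c, hc, hac⟩ := hsurj' (p-1-r) (p-1) (n+1) n (by ring) (by ring) _
      (d_mem_Zc_of_mem_Zc_succ B hb) (B.d_sq _ _ _ _)
    have hbc : b + c ∈ Zc B r p n :=
      add_mem (Zc_succ_le B r p n hb) (Zc_mono B r n (by omega) hc)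
    obtain ⟨a₂, ha₂, rfl⟩ := hinj' (p-r) p (n+1) n (by ring) (by ring) a₁
      (Zc_mono A r _ (by omega) ha₁) hda₁ _ hbc (by rw [map_add, ← hac]; abel)
    obtain ⟨a₃, ha₃, hda₃, e, he, hae⟩ := hsurj p n (φ.f n a₂ - (b + c))
      (sub_mem (φ.map_mem_Zc ha₂) hbc)
      (by rw [map_sub, map_add, ← hac, φ.comm]; abel)
    refine ⟨a₂ - a₃, mem_Zc_succ_of_d_mem_Zc A (sub_mem ha₂ ha₃) (by simpa [hda₃] using ha₁),
      mem_Bd_succ.2 ⟨c, hc, -e, neg_mem he, ?_⟩⟩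
    rw [map_neg, ← hae, map_sub]
    abel
  · intro p n a ha hφa
    obtain ⟨e, he, g, hg, heg⟩ := mem_Bd_succ.1 hφa
    have hde : B.d n (n+1) e = φ.f (n+1) (A.d n (n+1) a) := by
      rw [φ.comm, ← heg, map_add, B.d_sq, add_zero]
    obtain ⟨c, hc, hac⟩ := hinj' (p-1-r) (p-1) (n+1) n (by ring) (by ring) _
      (d_mem_Zc_of_mem_Zc_succ A ha) (A.d_sq _ _ _ _) e he hde.symm
    obtain ⟨a', ha', hda', h, hh, hah⟩ := hsurj (p-1) n (e - φ.f n c)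
      (sub_mem he (φ.map_mem_Zc hc)) (by rw [map_sub, hde, hac, φ.comm, sub_self])
    have hca : c + a' ∈ Zc A r (p-1) n := add_mem hc ha'
    obtain ⟨k, hk, hak⟩ := hinj' p (p+r) n (n-1) rfl rfl (a - (c + a'))
      (sub_mem (Zc_succ_le A r p n ha) (Zc_mono A r n (by omega) hca))
      (by rw [map_sub, map_add, hac, hda']; abel) (g - h)
      (sub_mem hg (Zc_mono B r _ (by omega) hh))
      (by rw [map_sub, map_add, map_sub, ← hah, ← heg]; abel)
    exact mem_Bd_succ.2 ⟨c + a', hca, k, hk, by rw [← hak]; abel⟩
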